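/- The subgroup K of 𝒢 generated by s_1, s_2 and s_7 is commutative, and the normal closure of {s_1, s_2, s_7} in 𝒢 is the whole group 𝒢. -/

import Mathlib

/-!
Symmetric generation of `M₂₂` (Hasan–Lim).  `G` is the quotient of the free
group on three generators `x, y, t` by the normal closure of the relators
`x^7, y^2, (xy)^3, [x,y]^4, t^2, [t^{x^2}, y x⁻¹], [t, y],
 (y t^{x^2})^5, (x y x^2 t^x)^5, (x t)^8`,
where `a ^ b := b⁻¹ a b` and `[a, b] := a⁻¹ b⁻¹ a b`.
-/

namespace M22

abbrev F := FreeGroup (Fin 3)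
def fx : F := FreeGroup.of 0
def fy : F := FreeGroup.of 1
def ft : F := FreeGroup.of 2

/-- conjugation `a ^ b = b⁻¹ * a * b` -/
def fconj (a b : F) : F := b⁻¹ * a * b
/-- commutator `[a, b] = a⁻¹ * b⁻¹ * a * b` -/
def fcomm (a b : F) : F := a⁻¹ * b⁻¹ * a * b

def rels : Set F :=
  {fx ^ 7, fy ^ 2, (fx * fy) ^ 3, (fcomm fx fy) ^ 4, ft ^ 2,
   fcomm (fconj ft (fx ^ 2)) (fy * fx⁻¹), fcomm ft fy,
   (fy * fconj ft (fx ^ 2)) ^ 5, (fx * fy * fx ^ 2 * fconj ft fx) ^ 5,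
   (fx * ft) ^ 8}

abbrev G := PresentedGroup rels

def x : G := PresentedGroup.of 0
def y : G := PresentedGroup.of 1
def t : G := PresentedGroup.of 2

/-- The symmetric generators `t₁, …, t₁₄`: for `1 ≤ i ≤ 7`, `tᵢ = t ^ (xⁱ)`,
and for `1 ≤ k ≤ 7`, `t₍₇₊ₖ₎ = t ^ (x⁵ y x^(k-1))`; the index is read modulo
`14` with representatives `1, …, 14`. -/
def tt (i : ℕ) : G :=
  let j := (i - 1) % 14 + 1
  if j ≤ 7 then (x ^ j)⁻¹ * t * x ^ j
  else (x ^ 5 * y * x ^ (j - 8))⁻¹ * t * (x ^ 5 * y * x ^ (j - 8))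

/-- `sᵢ = tᵢ t₍ᵢ₊₇₎`. -/
def s (i : ℕ) : G := tt i * tt (i + 7)

/-! ### A checker for derivations in a group

A word is written in decimal: the digits `1, 2, 3, 4` stand for `x, x⁻¹, y, t`, and `0` is the
empty word.  A step `1000 * p + 2 * k + d` applies rule number `k` at position `p`, from left to
right if `d = 1` and from right to left if `d = 0`. -/

/-- Decimal digits of `n`, most significant first, prepended to `acc`. -/
def decode : ℕ → ℕ → List ℕ → List ℕ
  | 0, _, acc => acc
  | f + 1, n, acc => match n with
    | 0 => acc
    | m + 1 => decode f ((m + 1) / 10) ((m + 1) % 10 :: acc)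

/-- The word with code `n`. -/
def wd (n : ℕ) : List ℕ := decode 100 n []

/-- Value of a letter. -/
def letter {H : Type*} [Group H] (x y t : H) : ℕ → H
  | 1 => x
  | 2 => x⁻¹
  | 3 => y
  | _ => t

/-- Value of a word. -/
def ev {H : Type*} [Group H] (x y t : H) (w : List ℕ) : H :=
  (w.map (letter x y t)).prod

/-- Remove the prefix `l`. -/
def strip : List ℕ → List ℕ → Option (List ℕ)
  | [], w => some w
  | _ :: _, [] => none
  | a :: l, b :: w => match Nat.beq a b with
    | true => strip l w
    | false => none

/-- Replace `l` by `r` at the given position. -/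
def replaceAt (l r : List ℕ) : ℕ → List ℕ → Option (List ℕ)
  | 0, w => (strip l w).map (r ++ ·)
  | _ + 1, [] => none
  | p + 1, a :: w => (replaceAt l r p w).map (a :: ·)

/-- One derivation step. -/
def step (rules : List (List ℕ × List ℕ)) (c : ℕ) (w : List ℕ) : Option (List ℕ) :=
  match rules[(c % 1000) / 2]? with
  | none => none
  | some (l, r) => match c % 2 with
    | 0 => replaceAt r l (c / 1000) w
    | _ => replaceAt l r (c / 1000) w

/-- A sequence of derivation steps. -/
def steps (rules : List (List ℕ × List ℕ)) : List ℕ → List ℕ → Option (List ℕ)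
  | [], w => some w
  | c :: cs, w => match step rules c w with
    | none => none
    | some v => steps rules cs v

/-- Check a list of derived rules, each with its derivation from the rules before it. -/
def extend (rules : List (List ℕ × List ℕ)) :
    List (ℕ × ℕ × List ℕ) → Option (List (List ℕ × List ℕ))
  | [] => some rules
  | (l, r, cs) :: es => match steps rules cs (wd l) with
    | none => none
    | some v => match decide (v = wd r) with
      | true => extend (rules ++ [(wd l, wd r)]) es
      | false => none

/-- Check that all `goals` are among the rules derived from `base`. -/
def verify (base : List (ℕ × ℕ)) (cert : List (ℕ × ℕ × List ℕ)) (goals : List (ℕ × ℕ)) : Bool :=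
  match extend (base.map fun e => (wd e.1, wd e.2)) cert with
  | none => false
  | some rules => goals.all fun e => decide ((wd e.1, wd e.2) ∈ rules)

section Soundness

variable {H : Type*} [Group H] (x y t : H)

theorem ev_append (u v : List ℕ) : ev x y t (u ++ v) = ev x y t u * ev x y t v := by
  simp [ev]

theorem ev_cons (a : ℕ) (v : List ℕ) : ev x y t (a :: v) = letter x y t a * ev x y t v := by
  simp [ev]

theorem strip_sound : ∀ (l w v : List ℕ), strip l w = some v → w = l ++ v
  | [], w, v, h => by simpa [strip] using h
  | _ :: _, [], v, h => by simp [strip] at h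
  | a :: l, b :: w, v, h => by
    rw [strip] at h
    split at h
    · rename_i hab
      rw [Nat.eq_of_beq_eq_true hab, strip_sound l w v h, List.cons_append]
    · simp at h

theorem replaceAt_sound (l r : List ℕ) (hlr : ev x y t l = ev x y t r) :
    ∀ (p : ℕ) (w v : List ℕ), replaceAt l r p w = some v → ev x y t w = ev x y t v
  | 0, w, v, h => by
    simp only [replaceAt, Option.map_eq_some_iff] at h
    obtain ⟨u, hu, rfl⟩ := h
    rw [strip_sound l w u hu, ev_append, ev_append, hlr]
  | _ + 1, [], v, h => by simp [replaceAt] at h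
  | p + 1, a :: w, v, h => by
    simp only [replaceAt, Option.map_eq_some_iff] at h
    obtain ⟨u, hu, rfl⟩ := h
    rw [ev_cons, ev_cons, replaceAt_sound l r hlr p w u hu]

/-- All rules hold in `H`. -/
def Valid (rules : List (List ℕ × List ℕ)) : Prop :=
  ∀ e ∈ rules, ev x y t e.1 = ev x y t e.2

theorem step_sound (rules : List (List ℕ × List ℕ)) (hr : Valid x y t rules) (c : ℕ)
    (w v : List ℕ) (h : step rules c w = some v) : ev x y t w = ev x y t v := by
  unfold step at h
  split at h
  · simp at h
  · rename_i l r hk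
    have hv : ev x y t l = ev x y t r := hr (l, r) (List.mem_of_getElem? hk)
    split at h
    · exact replaceAt_sound x y t r l hv.symm _ _ _ h
    · exact replaceAt_sound x y t l r hv _ _ _ h

theorem steps_sound (rules : List (List ℕ × List ℕ)) (hr : Valid x y t rules) :
    ∀ (cs w v : List ℕ), steps rules cs w = some v → ev x y t w = ev x y t v
  | [], w, v, h => by
    simp only [steps, Option.some.injEq] at h
    rw [h]
  | c :: cs, w, v, h => by
    rw [steps] at h
    split at h
    · simp at h
    · rename_i u hu
      rw [step_sound x y t rules hr c w u hu, steps_sound rules hr cs u v h]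

theorem extend_sound : ∀ (cert : List (ℕ × ℕ × List ℕ)) (rules rules' : List (List ℕ × List ℕ)),
    Valid x y t rules → extend rules cert = some rules' → Valid x y t rules'
  | [], rules, rules', hr, h => by
    simp only [extend, Option.some.injEq] at h
    rwa [← h]
  | (l, r, cs) :: es, rules, rules', hr, h => by
    rw [extend] at h
    split at h
    · simp at h
    · rename_i v hv
      split at h
      · rename_i hd
        refine extend_sound es _ rules' ?_ h
        intro e he
        rcases List.mem_append.1 he with he | he
        · exact hr e he
        · rw [List.mem_singleton.1 he]
          have := steps_sound x y t rules hr cs _ _ hv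
          rwa [of_decide_eq_true hd] at this
      · simp at h

theorem verify_sound (base : List (ℕ × ℕ)) (cert : List (ℕ × ℕ × List ℕ)) (goals : List (ℕ × ℕ))
    (hb : ∀ e ∈ base, ev x y t (wd e.1) = ev x y t (wd e.2)) (h : verify base cert goals = true) :
    ∀ e ∈ goals, ev x y t (wd e.1) = ev x y t (wd e.2) := by
  unfold verify at h
  split at h
  · simp at h
  · rename_i rules hrules
    have hv := extend_sound x y t cert _ rules (by
      intro e he
      obtain ⟨e', he', rfl⟩ := List.mem_map.1 he
      exact hb e' he') hrules
    intro e he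
    exact hv _ (of_decide_eq_true (List.all_eq_true.1 h e he))

end Soundness

/-- The defining relators of `G` as rewriting rules. -/
def baseRules : List (ℕ × ℕ) := [
  (12, 0),
  (21, 0),
  (33, 0),
  (44, 0),
  (1111111, 0),
  (131313, 0),
  (2313231323132313, 0),
  (22411132241132, 0),
  (4343, 0),
  (322411322411322411322411322411, 0),
  (1314113141131411314113141, 0),
  (1414141414141414, 0)]

/-- The rules `s₁ = s₂ = s₇ = 1`. -/
def extraRules : List (ℕ × ℕ) := [
  (2413222224111113, 0),
  (224132222241111131, 0),
  (2222222413222224111113111111, 0)]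

/-- The commutations to be derived. -/
def goalRules : List (ℕ × ℕ) := [
  (2413222224111113224132222241111131, 2241322222411111312413222224111113),
  (22222224132222241111131111112413222224111113, 24132222241111132222222413222224111113111111),
  (2241322222411111312222222413222224111113111111, 2222222413222224111113111111224132222241111131)]

set_option maxRecDepth 100000 in
/-- Derivation of the commutations from `baseRules`. -/
def certComm : List (ℕ × ℕ × List ℕ) := [
  (12, 0, [1]),
  (21, 0, [3]),
  (33, 0, [5]),
  (44, 0, [7]),
  (1111111, 0, [9]),
  (131313, 0, [11]),
  (2313231323132313, 0, [13]),
  (31313, 2, [26, 1035]),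
  (1313, 32, [28, 1039]),
  (313, 232, [26, 1041]),
  (2232223222322232, 0, [13042, 9042, 5042, 1042, 37]),
  (2323, 31, [42, 2029]),
  (323, 131, [24, 1047]),
  (31131, 23223, [2048, 43]),
  (32232, 13113, [2042, 49]),
  (111111, 2, [26, 1033]),
  (11111, 22, [26, 1055]),
  (1111, 222, [26, 1057]),
  (2222, 111, [1058, 27]),
  (23223111, 3113222, [50, 4059]),
  (13113222, 3223111, [52, 4061]),
  (232223222322232, 1, [24, 1045]),
  (32223222322232, 11, [24, 1067]),
  (2223222322232, 311, [28, 1069]),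
  (223222322232, 1311, [24, 1071]),
  (23222322232, 11311, [24, 1073]),
  (3222322232, 111311, [24, 1075]),
  (222322232, 3111311, [28, 1077]),
  (22322232, 13111311, [24, 1079]),
  (113111311, 2322232, [1080, 25]),
  (131113113, 2232231, [4052, 52, 1081, 43, 2027, 1051]),
  (131113111, 2232223, [80, 7027]),
  (31113113, 22232231, [26, 1085]),
  (322232231, 1113113, [1088, 29]),
  (222322311, 3113223, [88, 4051, 3025]),
  (22322311, 13113223, [24, 1093]),
  (113113223, 2322311, [1094, 25]),
  (131132231, 23113222, [94, 1063]),
  (31113111, 22232223, [26, 1087]),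
  (322232223, 1113111, [1100, 29]),
  (222322231, 31113222, [100, 5059]),
  (131113222, 22322231, [1104, 25]),
  (223113222, 31132231, [1098, 27]),
  (311132231, 132223113, [1060, 2088, 49, 2059]),
  (111322232, 23111311, [60, 2081, 1027]),
  (223111311, 11322232, [1112, 27]),
  (111322311, 23113223, [60, 2095, 1027]),
  (223113223, 11322311, [1116, 27]),
  (231113222, 111322231, [1104, 61]),
  (23222322, 11311131, [82, 8025]),
  (111311131, 3222322, [1122, 25]),
  (222311131, 13222322, [58, 1125]),
  (113222322, 22311131, [1126, 25]),
  (32223223, 11131132, [8024, 91]),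
  (111311322, 3223113, [130, 4053, 3027]),
  (23223113, 11311322, [1132, 27]),
  (322231132, 231113223, [1058, 2130, 43, 2061]),
  (222311322, 13223113, [58, 1133]),
  (113223113, 22311322, [1138, 25]),
  (322311132, 231132223, [64, 7042, 99]),
  (32223222, 11131113, [8028, 103]),
  (111311132, 32223111, [144, 5061]),
  (232223111, 11311132, [1146, 27]),
  (322231113, 111322231, [1058, 2144, 43, 2061, 121]),
  (222311132, 132223111, [58, 1147]),
  (1132223111, 22311132, [1152, 25]),
  (223222311, 13111322, [106, 8027]),
  (113111322, 23222311, [1156, 25]),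
  (311322311, 22311322, [108, 8027]),
  (322311322, 11322311, [1160, 29]),
  (1113222311, 23111322, [120, 8027]),
  (113223111, 32231132, [2064, 133]),
  (231132231, 132231132, [116, 1167]),
  (311322231, 132231113, [62, 7048, 135, 1065]),
  (223111322, 113222311, [1164, 27]),
  (4113222, 1132224, [0, 1000, 2004, 3002, 4002, 5002, 6006, 7000, 8000, 9015, 8001, 7001]),
  (43, 34, [2006, 3004, 17]),
  (43, 34, [177]),
  (4113, 1132224111, [4026, 5026, 6026, 175]),
  (4131, 3423, [1048, 177]),
  (4232, 3413, [1042, 177]),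
  (41113, 111322411, [5026, 6026, 5024, 3048, 5026, 6026, 175, 6175, 5027, 4027, 2049, 4025]),
  (42223, 1113224132, [5024, 1058, 4048, 6026, 5024, 3048, 5026, 6026, 175, 6175, 5027, 4027,
    2049, 4025]),
  (42232, 22322314231, [5026, 6028, 7024, 1024, 2088, 5052, 1094, 2050, 6060, 8028, 1116, 5024,
    3048, 5026, 6026, 175, 6175, 12177, 13175, 5027, 4027, 2049, 4025, 117, 7029, 5061, 1051, 95,
    4053, 1089, 25]),
  (42311, 22322314223, [5028, 2026, 3052, 7024, 1024, 2088, 5052, 1094, 2050, 6060, 8028, 1116,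
    5024, 3048, 5026, 6026, 175, 6175, 12177, 13175, 5027, 4027, 2049, 4025, 117, 7029, 5061,
    1051, 95, 4053, 1089, 25]),
  (413222, 1311131142231, [3058, 6028, 7024, 8024, 1080, 8024, 1106, 9028, 3060, 6050, 1110, 1024,
    2136, 3058, 6052, 2024, 3136, 175, 6177, 7175, 13175, 2137, 1025, 5053, 2059, 1137, 25, 111,
    5051, 2061, 8029, 107, 7025, 81]),
  (413223, 11322242231, [2024, 3050, 6024, 4060, 175]),
  (422311, 1311131141322, [6024, 4060, 7028, 1024, 2100, 1080, 8024, 1106, 9028, 3060, 6050, 1110,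
    1024, 2136, 3058, 6052, 2024, 3136, 175, 6177, 7175, 13175, 2137, 1025, 5053, 2059, 1137, 25,
    111, 5051, 2061, 8029, 107, 7025, 81]),
  (2413222224111113224132222241111131, 2241322222411111312413222224111113, [34002, 35004, 36000,
    37000, 38006, 39002, 40004, 41000, 42006, 43000, 44006, 45000, 46000, 47018, 1195, 27, 11025,
    7191, 6025, 5025, 4029, 3025, 2025, 43, 2027, 7059, 9027, 6191, 5025, 2185, 1029, 3029, 2025,
    8025, 8195, 7043, 5191, 4025, 1185, 4029, 3025, 6193, 5025, 2185, 1029, 3029, 2025, 5199,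
    1193, 11029, 10027, 9027, 8183, 6043, 1081, 27, 11197, 7193, 6025, 5025, 4029, 3025, 2025, 43,
    2027, 5043, 2189, 8195, 7027, 5049, 2059, 149, 7027, 6029, 3059, 5027, 9025, 5191, 3061, 159,
    5051, 2061, 13199, 9193, 5053, 2059, 1137, 173, 9029, 8025, 7025, 6029, 5027, 8029, 7027,
    6027, 5183, 14027, 18025, 14191, 10195, 6193, 2053, 6049, 125, 145, 147, 151, 165, 11029,
    10027, 9027, 8183, 16043, 13189, 9193, 5053, 2059, 1137, 173, 9029, 8025, 7025, 6029, 5027,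
    5199, 4027, 2049, 4059, 165, 8197, 7027, 6027, 5029, 4025, 3025, 2025, 6025, 2191, 1053, 27,
    3049, 11195, 7193, 6025, 5025, 4029, 3025, 2025, 43, 2027, 5029, 4027, 3027, 2183, 1029, 9025,
    8029, 7027, 12059, 14027, 15025, 14029, 13027, 12027, 11031, 10025, 9029, 8027, 7031, 6027,
    5031, 1193, 11043, 8189, 1095, 27, 161, 119, 7025, 6025, 6195, 5043, 7027, 6051, 3061, 159,
    5051, 2061, 13025, 13181, 9199, 1111, 27, 7029, 5059, 145, 125, 131, 7027, 3051, 2025, 6197,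
    141, 109, 7025, 3053, 89, 12025, 8191, 7025, 3053, 2027, 5029, 4025, 3025, 2029, 1027, 4025,
    7025, 6025, 6181, 4187, 1193, 11043, 8189, 1095, 27, 161, 119, 7025, 6025, 6195, 5043, 7027,
    6051, 3061, 159, 5051, 2061, 13025, 15025, 14025, 18025, 17025, 17181, 15187, 14027, 13181,
    9199, 1111, 27, 7029, 5059, 145, 125, 131, 7027, 3051, 2025, 6197, 141, 109, 7025, 3053, 89,
    12025, 8191, 7025, 3053, 2027, 5029, 4025, 3025, 2029, 1027, 4025, 7025, 6025, 8025, 7025,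
    11025, 10025, 10181, 8187, 7027, 6181, 4187, 1193, 11043, 8189, 1095, 27, 161, 119, 7025,
    6025, 6195, 5043, 7027, 6051, 3061, 159, 5051, 2061, 13025, 15025, 14025, 18025, 17025, 19025,
    18025, 22025, 21025, 23025, 22025, 21031, 20025, 19031, 27002, 28004, 29000, 30000, 31006,
    32002, 33004, 34000, 35000, 36006, 37002, 38006, 39000, 40006, 41004, 42000, 43000, 44006,
    45004, 46000, 47000, 48000, 49004, 50002, 51002, 52004, 53000, 54020, 26025, 25029, 24027,
    23027, 22031, 21025, 20029, 19027, 18027, 17031, 16025, 15031, 14027, 13031, 12029, 11027,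
    10027, 9031, 8029, 7027, 6027, 5043, 4025, 1171, 27, 7043, 6025, 7027, 7181, 3051, 131, 7027,
    6029, 5025, 4025, 6059, 9181, 8027, 7027, 5185, 3049, 59, 11059, 14181, 13027, 12027, 10185,
    5197, 153, 8025, 7025, 18059, 21181, 20027, 19027, 17185, 12197, 7199, 5051, 2061, 1111, 6051,
    3061, 159, 8029, 149, 7027, 11027, 9049, 7181, 83, 5049, 4027, 5025, 1053, 27, 6059, 6061,
    8025, 7025, 18059, 22025, 21179, 17189, 16027, 15027, 12183, 10043, 7189, 6059, 5189, 4027,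
    51, 4043, 123, 7025, 7195, 6043, 5025, 6027, 2051, 1025, 4043, 6027, 19029, 25181, 24027,
    21183, 17189, 16027, 15027, 12183, 10043, 7189, 6059, 1145, 59, 7029, 6025, 5025, 12029,
    20029, 19061, 25025, 24025, 23025, 22179, 18187, 17027, 14183, 10189, 9027, 8027, 5183, 3043,
    61, 7029, 15043, 13191, 9195, 8027, 5199, 4027, 3029, 59, 2027, 1027, 8027, 6049, 4181, 2059,
    123, 7025, 8059, 10027, 9027, 12043, 9189, 8027, 7181, 83, 5049, 4027, 5025, 1053, 27, 8025,
    7025, 7195, 5181, 4027, 51, 4029, 2061, 4025, 5059, 7027, 6027, 4193, 3025, 2025, 1029, 13025,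
    12029, 11027, 14025, 11185, 18031, 17025, 16025, 15179, 14029, 14031, 13025, 12031, 23002,
    24004, 25000, 26000, 27006, 28002, 29004, 30000, 31000, 32006, 33002, 34004, 35000, 36006,
    37004, 38000, 39000, 40006, 41002, 42002, 43006, 44002, 45004, 46000, 47000, 48004, 49002,
    50002, 51002, 52018, 22025, 21029, 20027, 19027, 18031, 17025, 16029, 15027, 14027, 13031,
    12025, 11029, 10027, 9031, 8029, 7027, 6027, 5031, 4025, 5193, 1081, 27, 6025, 4043, 3025,
    4027, 7029, 5061, 7025, 4181, 51, 4043, 123, 7025, 11025, 10025, 10181, 8187, 7027, 83, 5049,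
    4027, 5025, 1053, 27, 6025, 5025, 9025, 8025, 8181, 6187, 5027, 4181, 51, 4043, 123, 7025,
    11025, 10025, 12025, 11025, 15025, 14025, 14181, 12187, 11027, 10181, 8187, 7027, 83, 5049,
    4027, 5025, 1053, 27, 6025, 5025, 9025, 8025, 10025, 9025, 13025, 12025, 12181, 10187, 9027,
    8181, 6187, 5027, 4181, 51, 4043, 123, 7025, 11025, 10025, 12025, 11025, 15025, 14025, 16025,
    15025, 19025, 18025, 19059, 21027, 18191, 17025, 16185, 19049, 17181, 14193, 13025, 12185,
    15049, 13181, 10193, 9025, 8185, 6049, 3059, 10049, 8181, 155, 6049, 3059, 7025, 81, 7025,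
    8059, 10027, 13029, 11061, 13025, 14059, 16027, 19029, 17061, 19025, 20059, 22027, 25025,
    24029, 23027, 22031, 21027, 20027, 19031, 18025, 17025, 16179, 17031, 13191, 12025, 11025,
    10179, 18043, 16191, 15025, 11191, 7191, 6025, 5049, 2059, 6025, 5049, 4027, 10025, 9029,
    7189, 5059, 1053, 7027, 5049, 7025, 11027, 13043, 11191, 8197, 7027, 6043, 5025, 1065, 7025,
    11025, 7191, 6025, 5025, 4029, 2061, 9043, 7191, 6025, 5049, 2059, 6025, 5049, 4027, 7193,
    6025, 5025, 4029, 2061, 14025, 11185, 10029, 12029, 13193, 12025, 11025, 10179, 30002, 31004,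
    32000, 33000, 34006, 35002, 36004, 37000, 38000, 39006, 40004, 41000, 42000, 43006, 44004,
    45002, 46002, 47004, 48000, 49000, 50000, 51004, 52002, 53002, 54018, 29025, 28029, 27027,
    26027, 25031, 24025, 23029, 22027, 21027, 20031, 19029, 18027, 17027, 16031, 14043, 11189,
    7199, 1089, 25, 95, 99, 7027, 169, 8027, 12027, 10049, 8181, 4051, 1131, 59, 7027, 6029, 5025,
    4025, 6059, 6061, 8025, 8195, 5187, 4027, 139, 9059, 11027, 8199, 4051, 1131, 59, 6049, 127,
    7027, 6027, 5043, 2061, 6027, 16025, 15029, 14027, 13027, 12197, 11027, 10027, 9029, 8025,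
    14025, 10191, 8061, 7187, 1101, 25, 6043, 3061, 173, 8025, 10025, 9025, 8179, 6043, 3061,
    14181, 10193, 9025, 8185, 6049, 3059, 10049, 8181, 155, 6049, 3059, 7025, 81, 7025, 8059,
    10027, 13043, 10189, 9027, 8027, 12195, 11027, 9049, 7181, 1101, 25, 6029, 3061, 5025, 4025,
    5059, 7027, 6027, 5027, 4179, 2043, 12025, 8191, 7025, 6025, 5179, 3049, 2027, 16025, 15025,
    15181, 13187, 9193, 8025, 4191, 3025, 2049, 1027, 2025, 1049, 27, 5043, 3191, 2025, 1025, 29,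
    7025, 4185, 2043, 7029, 8199, 5187, 4027, 139, 9059, 11027, 8199, 4051, 1131, 59, 6049, 127,
    7027, 6027, 5043, 2061, 6027, 12197, 11027, 10027, 9029, 8025, 14025, 10191, 8061, 7187, 1101,
    25, 6043, 3061, 173, 8025, 10025, 9025, 8179, 6043, 3061, 16025, 15025, 19025, 18025, 18181,
    16187, 15027, 14181, 10193, 9025, 8185, 6049, 3059, 10049, 8181, 155, 6049, 3059, 7025, 81,
    7025, 8059, 10027, 13043, 10189, 9027, 8027, 12195, 11027, 9049, 7181, 1101, 25, 6029, 3061,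
    5025, 4025, 5059, 7027, 6027, 5027, 4179, 2043, 12025, 8191, 7025, 6025, 5179, 3049, 2027,
    16025, 15025, 17025, 16025, 20025, 19025, 19181, 17187, 16027, 15181, 13187, 9193, 8025, 4191,
    3025, 2049, 1027, 2025, 1049, 27, 5043, 3191, 2025, 1025, 29, 7025, 4185, 2043, 7029, 8199,
    5187, 4027, 139, 9059, 11027, 8199, 4051, 1131, 59, 6049, 127, 7027, 6027, 5043, 2061, 6027,
    12197, 11027, 10027, 9029, 8025, 14025, 10191, 8061, 7187, 1101, 25, 6043, 3061, 173, 8025,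
    10025, 9025, 8179, 6043, 3061, 16025, 15025, 19025, 18025, 20025, 19025, 23025, 22025, 23059,
    22189, 21059, 20189, 19027, 18181, 16187, 15027, 14181, 10193, 9025, 8185, 6049, 3059, 10049,
    8181, 155, 6049, 3059, 7025, 81, 7025, 8059, 10027, 13043, 10189, 9027, 8027, 12195, 11027,
    9049, 7181, 1101, 25, 6029, 3061, 5025, 4025, 5059, 7027, 6027, 5027, 4179, 2043, 12025, 8191,
    7025, 6025, 5179, 3049, 2027, 16025, 15025, 17025, 16025, 20025, 19025, 19195, 17181, 16027,
    15195, 13181, 9193, 8025, 4191, 3025, 2049, 1027, 2025, 1049, 27, 5043, 3191, 2025, 1025, 29,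
    7025, 4185, 2043, 7029, 11043, 8189, 6059, 8027, 5191, 1081, 27, 6025, 4043, 3025, 4027, 7025,
    7195, 6043, 4191, 3053, 89, 7025, 6029, 5027, 5193, 1081, 27, 6025, 4043, 3025, 4027, 4199,
    51, 4029, 3027, 2027, 1043, 3027, 4197, 173, 8025, 8199, 6051, 3061, 159, 5051, 2061, 1111,
    27, 7029, 5059, 145, 12027, 16025, 12191, 8195, 125, 131, 7027, 3051, 2025, 5043, 7027, 11043,
    8189, 155, 7027, 6029, 5025, 4025, 4195, 2051, 1095, 27, 6029, 5027, 4027, 8025, 7029, 6027,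
    11059, 13027, 12027, 10193, 9025, 6185, 9029, 8025, 21059, 23027, 22027, 20193, 19025, 15191,
    11191, 10025, 7185, 6029, 8029, 7025, 13025, 12029, 10189, 6193, 4189, 51, 135, 1065, 7025,
    7195, 2115, 65, 143, 1171, 27, 7029, 4059, 53, 6027, 9043, 6189, 5027, 1051, 25, 3043, 145,
    12027, 12199, 11027, 10029, 9059, 8189, 125, 6027, 5027, 4029, 1061, 3025, 6027, 3183, 7197,
    4193, 3053, 89, 7025, 6029, 5027, 8029, 6061, 8025, 12025, 8191, 7025, 6025, 5179, 3049, 2027,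
    16027, 18043, 16191, 13197, 9193, 8025, 4191, 3025, 2049, 1027, 2025, 1049, 27, 5043, 3191,
    2025, 1025, 29, 7025, 4185, 2043, 7029, 11043, 8189, 6059, 8027, 5191, 1081, 27, 6025, 4043,
    3025, 4027, 7025, 7195, 6043, 4191, 3053, 89, 7025, 6029, 5027, 5193, 1081, 27, 6025, 4043,
    3025, 4027, 4199, 51, 4029, 3027, 2027, 1043, 3027, 4197, 173, 8025, 8199, 6051, 3061, 159,
    5051, 2061, 1111, 27, 7029, 5059, 145, 12027, 16025, 12191, 8195, 125, 131, 7027, 3051, 2025,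
    5043, 7027, 11043, 8189, 155, 7027, 6029, 5025, 4025, 4195, 2051, 1095, 27, 6029, 5027, 4027,
    8025, 7029, 6027, 14025, 10191, 9025, 6185, 9029, 8025, 13043, 11191, 10025, 7185, 6029, 8029,
    7025, 10193, 9025, 6185, 9029, 8025, 18025, 15185, 14029, 16029, 26195, 21199, 20043, 17189,
    15059, 17027, 14191, 12061, 11187, 7193, 4185, 3029, 5049, 3181, 1059, 145, 9059, 9061, 11025,
    8181, 125, 6027, 4049, 3027, 4025, 53, 7059, 10199, 9027, 6199, 5027, 4029, 2059, 4027, 11027,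
    9049, 7181, 5059, 1053, 97, 6025, 5025, 1053, 27, 5059, 7027, 6027, 6197, 5027, 4195, 51,
    4029, 3027, 2027, 1043, 3027, 13025, 9191, 8025, 4191, 3025, 2049, 1027, 2025, 1049, 27, 5043,
    3191, 2025, 1025, 29, 7025, 4185, 2043, 7029, 14025, 13025, 12179, 10043, 8191, 7025, 6025,
    5179, 3049, 2027, 18025, 22027, 21027, 18183, 17029, 19029, 18027, 19197, 17187, 16027, 15181,
    13187, 9193, 8025, 4191, 3025, 2049, 1027, 2025, 1049, 27, 5043, 3191, 2025, 1025, 29, 7025,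
    4185, 2043, 7029, 8199, 5187, 4027, 139, 9059, 11027, 8199, 4051, 1131, 59, 6049, 127, 7027,
    6027, 5043, 2061, 6027, 12197, 11027, 10027, 9029, 8025, 14025, 10191, 8061, 7187, 1101, 25,
    6043, 3061, 173, 8025, 10025, 9025, 8179, 6043, 3061, 16025, 15025, 19025, 18025, 20025,
    19025, 20199, 19027, 18179, 19187, 16183, 17193, 14185, 12043, 10191, 9025, 8185, 6049, 3059,
    10049, 8181, 155, 6049, 3059, 7025, 81, 7025, 8059, 10027, 16049, 14181, 10193, 8061, 7187,
    1101, 25, 6043, 3061, 173, 8025, 10025, 9025, 8179, 6043, 3061, 13043, 10189, 9059, 8189,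
    7027, 83, 5049, 4027, 5025, 1053, 27, 4195, 51, 4029, 3027, 2027, 1043, 3027, 9195, 4199,
    2051, 1095, 27, 6029, 5027, 4027, 4197, 51, 4043, 123, 7025, 8199, 7027, 6029, 3059, 5027,
    4027, 2049, 11027, 10027, 9029, 15025, 11191, 10025, 9025, 7197, 4059, 6027, 3053, 59, 139,
    8199, 4051, 1131, 59, 6049, 127, 7027, 6027, 5043, 2061, 6027, 17059, 17061, 19025, 16181,
    12193, 7195, 1089, 25, 95, 99, 7027, 169, 8027, 12025, 11029, 9061, 8187, 4051, 1131, 59,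
    7027, 3051, 61, 6029, 4061, 14043, 11189, 8059, 10027, 9027, 7185, 12195, 11027, 10029, 9059,
    8189, 125, 6027, 5027, 4029, 1061, 3025, 6027, 3183, 11025, 7191, 4185, 3029, 5049, 3181,
    1059, 145, 9059, 9061, 11025, 8181, 125, 6027, 4049, 3027, 4025, 53, 7059, 15059, 21029,
    19061, 23059, 30027, 29027, 28029, 34025, 33029, 32027, 31027, 30179, 26187, 25027, 24027,
    23027, 22179, 18187, 17027, 16027, 15027, 14179, 12043, 10191, 7061, 9025, 6181, 5027, 1051,
    25, 3029, 1061, 3025, 6025, 5025, 3183, 23031, 22025, 21025, 20179, 21031, 17191, 16025,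
    15025, 14179, 23025, 22029, 21027, 20031, 19025, 15191, 11191, 10025, 7185, 6029, 8029, 7025,
    13025, 12029, 10189, 6193, 4189, 51, 135, 1065, 7025, 7195, 2115, 65, 143, 1171, 27, 7029,
    4059, 53, 6027, 9043, 6189, 5027, 1051, 25, 3043, 145, 12027, 12199, 11027, 10029, 9059, 8189,
    125, 6027, 5027, 4029, 1061, 3025, 6027, 3183, 7197, 4193, 3053, 89, 7025, 6029, 5027, 8029,
    6061, 8025, 12025, 8191, 7025, 6025, 5179, 3049, 2027, 16027, 18043, 16191, 13197, 9193, 8025,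
    4191, 3025, 2049, 1027, 2025, 1049, 27, 5043, 3191, 2025, 1025, 29, 7025, 4185, 2043, 7029,
    11043, 8189, 6059, 8027, 5191, 1081, 27, 6025, 4043, 3025, 4027, 7025, 7195, 6043, 4191, 3053,
    89, 7025, 6029, 5027, 5193, 1081, 27, 6025, 4043, 3025, 4027, 4199, 51, 4029, 3027, 2027,
    1043, 3027, 4197, 173, 8025, 8199, 6051, 3061, 159, 5051, 2061, 1111, 27, 7029, 5059, 145,
    12027, 16025, 12191, 8195, 125, 131, 7027, 3051, 2025, 5043, 7027, 11043, 8189, 155, 7027,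
    6029, 5025, 4025, 4195, 2051, 1095, 27, 6029, 5027, 4027, 8025, 7029, 6027, 14025, 10191,
    9025, 6185, 9029, 8025, 13043, 11191, 10025, 7185, 6029, 8029, 7025, 10193, 9025, 6185, 9029,
    8025, 15193, 11191, 10025, 7185, 6029, 8029, 7025, 13025, 12029, 10189, 6193, 4189, 51, 135,
    1065, 7025, 7195, 2115, 65, 143, 1171, 27, 7029, 4059, 53, 6027, 9043, 6189, 5027, 1051, 25,
    3043, 145, 12027, 12199, 11027, 10029, 9059, 8189, 125, 6027, 5027, 4029, 1061, 3025, 6027,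
    3183, 7197, 4193, 3053, 89, 7025, 6029, 5027, 8029, 6061, 8025, 12025, 8191, 7025, 6025, 5179,
    3049, 2027, 16027, 20004, 21000, 22000, 23006, 24004, 25002, 26006, 27002, 28004, 29000,
    30006, 31002, 32004, 33000, 34000, 35006, 36004, 37000, 38000, 39004, 40002, 41002, 42020,
    19029, 18027, 17027, 16031, 15029, 14025, 13031, 12025, 11029, 10027, 9031, 8025, 7029, 6027,
    5027, 4031, 2043, 4027, 3043, 61, 6027, 8181, 117, 169, 7049, 9025, 1143, 25, 10059, 13181,
    12027, 11027, 9185, 7049, 6027, 14059, 17181, 16027, 15027, 13185, 8197, 161, 7027, 5049,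
    7025, 173, 20059, 23181, 22027, 21027, 19185, 14197, 9199, 155, 6049, 3059, 157, 7027, 6027,
    5029, 2059, 4027, 8027, 6049, 4181, 3027, 2027, 1029, 25, 3059, 3061, 5025, 4025, 15059,
    18187, 17027, 16027, 15027, 14179, 9197, 4199, 2181, 1027, 27, 5059, 7027, 6027, 4193, 1061,
    3025, 16027, 14049, 12181, 8199, 161, 119, 167, 7027, 3051, 131, 6049, 125, 6027, 5027, 5197,
    137, 5053, 2059, 1137, 173, 14025, 10191, 2137, 1025, 5053, 2059, 8029, 7025, 6025, 5029,
    4027, 7025, 8059, 8061, 10025, 9025, 19025, 18025, 17179, 18031, 14191, 13025, 9191, 8025,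
    7185, 6029, 8049, 6181, 5027, 4195, 3027, 1049, 3059, 15059, 17027, 19043, 17191, 15061,
    14187, 9199, 155, 6049, 3059, 157, 7027, 6027, 5029, 2059, 4027, 8027, 7027, 6029, 5025, 8025,
    7025, 6179, 12025, 9185, 12029, 16025, 15029, 14027, 13031, 12025, 10183, 9029, 19004, 20000,
    21000, 22006, 23004, 24002, 25006, 26004, 27000, 28006, 29002, 30006, 31000, 32006, 33000,
    34000, 35018, 18029, 17027, 16027, 15031, 14029, 13025, 12031, 11029, 10027, 9031, 8025, 7031,
    8181, 4193, 2061, 1111, 13043, 10189, 6051, 3061, 159, 5051, 2061, 1111, 27, 7029, 6025, 5025,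
    5195, 4043, 1061, 5027, 89, 1095, 27, 12025, 8191, 7025, 3053, 89, 6043, 1081, 27, 6025, 5025,
    4029, 1059, 11025, 10025, 10181, 8187, 4193, 1061, 3025, 8199, 161, 119, 167, 7027, 3051, 131,
    6049, 125, 6027, 5027, 5197, 137, 5053, 2059, 1137, 173, 14025, 10191, 2137, 1025, 5053, 2059,
    8029, 7025, 6025, 5029, 4027, 10025, 9025, 13025, 12025, 12181, 10187, 9027, 8181, 4193, 2061,
    1111, 13043, 10189, 6051, 3061, 159, 5051, 2061, 1111, 27, 7029, 6025, 5025, 5195, 4043, 1061,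
    5027, 89, 1095, 27, 12025, 8191, 7025, 3053, 89, 6043, 1081, 27, 6025, 5025, 4029, 1059,
    11025, 10025, 12025, 11025, 15025, 14025, 14181, 12187, 11027, 10181, 8187, 4193, 1061, 3025,
    8199, 161, 119, 167, 7027, 3051, 131, 6049, 125, 6027, 5027, 5197, 137, 5053, 2059, 1137, 173,
    14025, 10191, 2137, 1025, 5053, 2059, 8029, 7025, 6025, 5029, 4027, 10025, 9025, 13025, 12025,
    14025, 13025, 17025, 16025, 16181, 14187, 13027, 12181, 10187, 9027, 8181, 4193, 2061, 1111,
    13043, 10189, 6051, 3061, 159, 5051, 2061, 1111, 27, 7029, 6025, 5025, 5195, 4043, 1061, 5027,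
    89, 1095, 27, 12025, 8191, 7025, 3053, 89, 6043, 1081, 27, 6025, 5025, 4029, 1059, 11025,
    10025, 12025, 11025, 15025, 14025, 16025, 15025, 19025, 18025, 20025, 19025, 18031, 17025,
    16031, 15027, 14031, 13025, 12179, 13031, 12043, 10191, 9025, 8185, 6043, 4191, 1061, 3025,
    14049, 12181, 8193, 7025, 3053, 89, 6043, 1081, 27, 6025, 5025, 4029, 1059, 7043, 4189, 3027,
    2027, 1027, 29, 2195, 1027, 12025, 8191, 7025, 6025, 5029, 4025, 3025, 1043, 3027, 8059,
    10027, 17026, 15058, 10026, 8058, 3026, 1042, 3024, 4024, 5028, 6024, 7024, 8190, 12024, 1026,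
    2194, 28, 1026, 2026, 3026, 4188, 7042, 1058, 4028, 5024, 6024, 26, 1080, 6042, 88, 3052,
    7024, 8192, 12180, 14048, 3024, 1060, 4190, 6042, 8184, 9024, 10190, 14024, 9026, 10028, 1058,
    4028, 5024, 6024, 26, 1080, 6042, 88, 3052, 7024, 8190, 10042, 12182, 15026, 16026, 3024,
    1060, 4190, 8024, 26, 1026, 2196, 2026, 58, 3028, 4026, 5026, 6026, 7028, 60, 1100, 8198,
    4048, 1026, 2052, 3192, 7188, 10042, 11194, 11024, 10026, 8058, 3026, 1042, 3024, 4024, 5028,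
    6024, 7024, 8190, 12024, 1026, 2194]),
  (22222224132222241111131111112413222224111113, 24132222241111132222222413222224111113111111,
    [61, 2025, 1025, 25, 195, 12025, 8191, 7025, 6025, 5029, 4025, 3025, 1043, 25, 1027, 6059,
    8027, 5199, 1193, 53, 4049, 11029, 10027, 9027, 8183, 1089, 25, 15027, 14027, 11183, 9043,
    7191, 6025, 2053, 1027, 4029, 3025, 2025, 1029, 27, 7025, 7195, 6043, 4191, 3025, 185, 3029,
    2025, 5193, 4025, 1185, 29, 2029, 1025, 4199, 193, 10029, 9027, 8027, 7183, 5043, 81, 12197,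
    8193, 7025, 6025, 5029, 4025, 3025, 1043, 25, 1027, 4043, 1189, 7195, 6027, 4049, 1059, 5059,
    145, 7029, 4059, 6027, 10025, 6191, 4061, 147, 7025, 4051, 1061, 12199, 8193, 4053, 1059, 137,
    8029, 121, 8025, 7029, 6027, 9029, 8027, 7027, 6183, 15027, 19025, 15191, 11195, 7193, 3053,
    59, 6049, 127, 1145, 59, 153, 1151, 59, 105, 7027, 10029, 9027, 8027, 7183, 15043, 12189,
    8193, 4053, 1059, 137, 8029, 121, 8025, 7029, 6027, 6199, 5027, 3049, 59, 4059, 105, 7027,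
    7197, 6027, 5027, 4029, 3025, 2025, 1025, 5025, 1191, 53, 4049, 12195, 8193, 7025, 6025, 5029,
    4025, 3025, 1043, 25, 1027, 4029, 3027, 2027, 1183, 29, 8025, 7029, 6027, 11059, 13027, 14024,
    13026, 11058, 6026, 7028, 8024, 28, 1182, 2026, 3026, 4028, 1026, 24, 1042, 3024, 4024, 5028,
    6024, 7024, 8192, 12194, 4048, 52, 1190, 5024, 1024, 2024, 3024, 4028, 5026, 6026, 7196, 7026,
    104, 4058, 58, 3048, 5026, 6198, 6026, 7028, 8024, 120, 8028, 136, 1058, 4052, 8192, 12188,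
    15042, 7182, 8026, 9026, 10028, 7026, 104, 58, 1150, 152, 58, 1144, 126, 6048, 58, 3052, 7192,
    11194, 15190, 19024, 15026, 6182, 7026, 8026, 9028, 6026, 7028, 8024, 120, 8028, 136, 1058,
    4052, 8192, 12198, 1060, 4050, 7024, 146, 4060, 6190, 10024, 6026, 4058, 7028, 144, 5058,
    1058, 4048, 6026, 7194, 1188, 4042, 1026, 24, 1042, 3024, 4024, 5028, 6024, 7024, 8192, 12196,
    80, 5042, 7182, 8026, 9026, 10028, 192, 4198, 1024, 2028, 28, 1184, 4024, 5192, 2024, 3028,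
    184, 3024, 4190, 6042, 7194, 7024, 1024, 2028, 28, 1184, 4024, 5190, 8026, 6058, 1026, 24,
    1042, 3024, 4024, 5028, 6024, 7024, 8190, 12024, 194, 24, 1201, 25, 1195, 27, 11025, 7191,
    6025, 5025, 4029, 3025, 2025, 43, 2027, 7059, 9027, 10025, 10195, 9043, 6189, 2193, 1053, 27,
    3049, 7199, 101, 7029, 6027, 5027, 4027, 3029, 2027, 1027, 1197, 27, 9025, 5191, 2061, 4025,
    99, 16027, 15027, 12183, 10043, 8191, 5061, 1051, 95, 4053, 1089, 25, 5043, 81, 7025, 6025,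
    5029, 2059, 11029, 10027, 15025, 11191, 10025, 9185, 7043, 5191, 2061, 4025, 99, 14049, 12181,
    8193, 5061, 1051, 95, 4053, 1089, 25, 5043, 81, 7025, 6025, 5029, 2059, 8043, 5189, 4027,
    3027, 2027, 1029, 25, 1195, 27, 11025, 7191, 6025, 5025, 4029, 3025, 2025, 43, 2027, 7059,
    9027, 14059, 16027, 13191, 12025, 9185, 12029, 11025, 3024, 4028, 1184, 4024, 5192, 2024,
    3028, 1028, 2184, 5024, 6190, 8042, 3024, 4028, 1184, 4024, 5190, 9024, 1026, 2028, 3024,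
    4024, 5028, 2026, 3052, 7024, 8190, 12024, 2050, 3026, 1042, 2194, 2024, 3024, 4028, 5026,
    6026, 7026, 8188, 11042, 98, 4024, 2060, 5192, 9196, 12190, 14042, 16182, 19026, 20026, 11182,
    12026, 13026, 14028, 2058, 5028, 6024, 7024, 80, 5042, 24, 1088, 4052, 94, 1050, 5060, 8190,
    10042, 12178, 13024, 14024, 98, 4024, 2060, 5190, 9024, 26, 1196, 1026, 2026, 3028, 4026,
    5026, 6026, 7028, 100, 7198, 3048, 26, 1052, 2192, 6186, 7060, 9192, 13198, 16026, 14058,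
    9026, 7058, 2026, 42, 2024, 3024, 4028, 5024, 6024, 7190, 11024, 26, 1194, 24, 1028, 2026,
    3026, 4026, 5188, 8042, 2058, 5028, 6024, 7024, 80, 5042, 24, 1088, 4052, 94, 1050, 5060,
    8192, 12180, 14048, 98, 4024, 2060, 5190, 7042, 9184, 10024, 11190, 15024, 10026, 11028, 2058,
    5028, 6024, 7024, 80, 5042, 24, 1088, 4052, 94, 1050, 5060, 8190, 10042, 12182, 15026, 16026,
    98, 4024, 2060, 5190, 9024, 26, 1196, 1026, 2026, 3028, 4026, 5026, 6026, 7028, 100, 7198,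
    3048, 26, 1052, 2192, 6188, 9042, 10194, 10024, 1182, 2026, 3026, 4028, 1026, 2028, 3024,
    4024, 5028, 2026, 3052, 7024, 8192, 12194, 1190, 3042, 5184, 8024, 2024, 3028, 1028, 2184,
    5024, 6190, 9026, 7058, 2026, 42, 2024, 3024, 4028, 5024, 6024, 7190, 11024, 26, 1194]),
  (2241322222411111312222222413222224111113111111, 2222222413222224111113111111224132222241111131,
    [2195, 1027, 12025, 8191, 7025, 6025, 5029, 4025, 3025, 1043, 3027, 8059, 10027, 11025, 7191,
    6025, 3185, 2029, 4029, 3025, 9025, 6185, 4043, 2191, 61, 12195, 8193, 7025, 3053, 59, 6029,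
    5025, 4025, 3029, 2027, 5029, 4027, 3027, 2183, 12195, 7199, 3193, 2053, 1027, 4049, 11029,
    10027, 9027, 8183, 1089, 61, 12197, 8193, 7025, 3053, 59, 6029, 5025, 4025, 3029, 2027, 5043,
    2189, 1027, 27, 4195, 3027, 1049, 3059, 13025, 9191, 8025, 7025, 6029, 3061, 5025, 2051, 1025,
    9199, 5193, 1053, 5049, 7025, 6049, 3059, 12029, 11027, 10027, 9183, 18027, 17027, 16029,
    22025, 18191, 17025, 16025, 14197, 10193, 2137, 1025, 5053, 2059, 8029, 7025, 6025, 5029,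
    4027, 7043, 4189, 3027, 2027, 1043, 25, 4195, 3027, 1115, 13025, 9191, 1129, 8025, 7029, 6025,
    5025, 3043, 5027, 9199, 5193, 131, 133, 6049, 1115, 12029, 11027, 10027, 9183, 7049, 6027,
    22059, 24027, 21199, 17193, 12195, 8193, 7025, 3053, 89, 6043, 1081, 27, 6025, 5025, 4029,
    1059, 7029, 6027, 5027, 4183, 13025, 12029, 10061, 9187, 5193, 131, 133, 6049, 1115, 9199,
    8027, 7029, 6027, 5027, 4027, 3029, 1059, 4197, 3027, 2027, 49, 2025, 8025, 4191, 2061, 1111,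
    21029, 20027, 19027, 18183, 14187, 10193, 2137, 1025, 5053, 2059, 8029, 7025, 6025, 5029,
    4027, 4199, 3027, 1049, 3059, 9197, 155, 7027, 6029, 5025, 4025, 3025, 7025, 3191, 2053, 1027,
    4049, 23027, 22027, 19183, 17043, 15191, 14025, 13025, 12179, 10043, 8191, 7025, 6025, 5029,
    4025, 3025, 1043, 3027, 17024, 18028, 19026, 20026, 3026, 1042, 3024, 4024, 5028, 6024, 7024,
    8190, 10042, 12178, 13024, 14024, 15190, 19024, 15024, 13060, 15028, 9024, 10028, 112, 6042,
    8184, 11024, 12192, 15196, 60, 2190, 4042, 6182, 9026, 2026, 3028, 4024, 5024, 6028, 58, 3052,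
    7024, 8190, 12024, 60, 1088, 4052, 116, 1162, 5196, 1024, 2050, 6026, 5024, 6042, 7026, 148,
    8028, 158, 3060, 6050, 10198, 1110, 2060, 4192, 8188, 9058, 10028, 11026, 12198, 12026, 4026,
    5028, 6024, 7024, 8028, 2058, 5052, 1024, 2136, 10190, 14024, 172, 1136, 2058, 5052, 136,
    5196, 5026, 6026, 124, 6048, 130, 3050, 7026, 166, 118, 160, 8198, 3024, 1060, 4192, 8188,
    11042, 4028, 5182, 6026, 7026, 8028, 5026, 3042, 5024, 6024, 7028, 8024, 1128, 9192, 13194,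
    1114, 6048, 132, 130, 5190, 9024, 5024, 6024, 7024, 146, 4060, 7042, 60, 1100, 8196, 1026,
    2198, 2026, 3028, 4024, 5024, 6028, 58, 3052, 7024, 8192, 12188, 14192, 18188, 21042, 21026,
    19058, 14026, 15028, 16024, 60, 1088, 8182, 9026, 10026, 11028, 4048, 1026, 2052, 3192, 7194,
    3026, 1042, 3024, 4024, 5028, 6024, 7024, 8190, 12024, 112, 8024, 120, 8028, 2060, 5050, 158,
    3060, 6050, 10196, 1110, 2060, 5050, 6026, 4042, 5198, 1024, 2050, 5024, 3060, 6028, 7024,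
    8024, 9192, 13188, 16042, 9028, 10182, 11026, 12026, 13028, 1110, 2060, 4192, 8194, 12190,
    16024, 12026, 4028, 5182, 6026, 7026, 8028, 1024, 2050, 5024, 3060, 6028, 7024, 8024, 9192,
    13198, 3058, 6048, 7024, 5048, 1052, 5190, 9024, 1024, 2050, 6026, 5024, 6042, 7026, 148,
    8028, 158, 3060, 6050, 10194, 172, 1136, 2058, 5052, 164, 60, 1100, 8188, 11042, 4048, 1026,
    2052, 3192, 7196, 2182, 3026, 4026, 5028, 2026, 3028, 4024, 5024, 6028, 58, 3052, 7024, 8192,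
    12198, 9024, 10028, 60, 1088, 8184, 11024, 12192, 9024, 10028, 112, 6042, 8184, 11024, 12190,
    14042, 15194, 15024, 9024, 10028, 60, 1088, 8184, 11024, 12190, 15026, 13058, 4048, 1026,
    2052, 3190, 7024, 3026, 4026, 5028, 1050, 5026, 6026, 7028, 116, 8194, 60, 1088, 4052, 8201,
    4053, 1089, 61, 7025, 7195, 6043, 113, 1101, 61, 165, 1111, 27, 4051, 1061, 12025, 8191, 4053,
    1059, 137, 8029, 121, 8025, 7029, 6027, 11059, 13027, 14025, 14195, 13043, 10189, 6193, 4061,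
    147, 7025, 4051, 1061, 8199, 111, 8029, 6059, 1145, 59, 127, 1131, 59, 7027, 3051, 61, 7197,
    117, 7029, 5061, 1051, 95, 4053, 1089, 25, 11025, 7191, 6025, 2053, 1027, 4029, 3025, 2025,
    1029, 27, 8027, 7027, 4183, 2043, 191, 13029, 12027, 17025, 13191, 12025, 11185, 9043, 7191,
    6025, 2053, 1027, 4029, 3025, 2025, 1029, 27, 6049, 4181, 193, 10043, 7189, 95, 99, 7027,
    4053, 1089, 61, 7025, 7195, 6043, 113, 1101, 61, 165, 1111, 27, 4051, 1061, 12025, 8191, 4053,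
    1059, 137, 8029, 121, 8025, 7029, 6027, 11059, 13027, 18059, 20027, 20029, 19027, 18027,
    17179, 15043, 13191, 11061, 10187, 6193, 4061, 147, 7025, 4051, 1061, 8199, 111, 8029, 6059,
    1145, 59, 127, 1131, 59, 7027, 3051, 61, 7197, 117, 7029, 5061, 1051, 95, 4053, 1089, 25,
    11025, 7191, 6025, 2053, 1027, 4029, 3025, 2025, 1029, 27, 6025, 5025, 4179, 2043, 191, 20026,
    18058, 190, 2042, 4178, 5024, 6024, 26, 1028, 2024, 3024, 4028, 1026, 2052, 6024, 7190, 11024,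
    24, 1088, 4052, 94, 1050, 5060, 7028, 116, 7196, 60, 3050, 7026, 58, 1130, 126, 58, 1144,
    6058, 8028, 110, 8198, 1060, 4050, 7024, 146, 4060, 6192, 10186, 11060, 13190, 17024, 13026,
    11058, 6026, 7028, 8024, 120, 8028, 136, 1058, 4052, 8190, 12024, 1060, 4050, 26, 1110, 164,
    60, 1100, 112, 6042, 7194, 7024, 60, 1088, 4052, 7026, 98, 94, 7188, 10042, 192, 4180, 5026,
    6028, 26, 1028, 2024, 3024, 4028, 1026, 2052, 6024, 7190, 9042, 11182, 14194, 190, 2042, 4184,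
    7024, 26, 1028, 2024, 3024, 4028, 1026, 2052, 6024, 7190, 9042, 11182, 14026, 15026, 24, 1088,
    8182, 9026, 10026, 11028, 4048, 52, 1192, 5198, 8026, 6058, 1026, 24, 1042, 3024, 4024, 5028,
    6024, 7024, 8190, 12024, 194, 24, 1024, 2024, 60])]

set_option maxRecDepth 100000 in
/-- Derivation of `x = y = t = 1` from `baseRules ++ extraRules`. -/
def certTriv : List (ℕ × ℕ × List ℕ) := [
  (12, 0, [1]),
  (21, 0, [3]),
  (33, 0, [5]),
  (44, 0, [7]),
  (1111111, 0, [9]),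
  (131313, 0, [11]),
  (2313231323132313, 0, [13]),
  (31313, 2, [32, 1041]),
  (1313, 32, [34, 1045]),
  (313, 232, [32, 1047]),
  (2232223222322232, 0, [13048, 9048, 5048, 1048, 43]),
  (2323, 31, [48, 2035]),
  (323, 131, [30, 1053]),
  (31131, 23223, [2054, 49]),
  (32232, 13113, [2048, 55]),
  (111111, 2, [32, 1039]),
  (11111, 22, [32, 1061]),
  (1111, 222, [32, 1063]),
  (2222, 111, [1064, 33]),
  (23223111, 3113222, [56, 4065]),
  (13113222, 3223111, [58, 4067]),
  (232223222322232, 1, [30, 1051]),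
  (32223222322232, 11, [30, 1073]),
  (2223222322232, 311, [34, 1075]),
  (223222322232, 1311, [30, 1077]),
  (23222322232, 11311, [30, 1079]),
  (3222322232, 111311, [30, 1081]),
  (222322232, 3111311, [34, 1083]),
  (22322232, 13111311, [30, 1085]),
  (113111311, 2322232, [1086, 31]),
  (131113113, 2232231, [4058, 58, 1087, 49, 2033, 1057]),
  (131113111, 2232223, [86, 7033]),
  (31113113, 22232231, [32, 1091]),
  (322232231, 1113113, [1094, 35]),
  (222322311, 3113223, [94, 4057, 3031]),
  (22322311, 13113223, [30, 1099]),
  (131132231, 23113222, [100, 1069]),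
  (31113111, 22232223, [32, 1093]),
  (322232223, 1113111, [1104, 35]),
  (222322231, 31113222, [104, 5065]),
  (131113222, 22322231, [1108, 31]),
  (223113222, 31132231, [1102, 33]),
  (311132231, 132223113, [1066, 2094, 55, 2065]),
  (111322232, 23111311, [66, 2087, 1033]),
  (223111311, 11322232, [1116, 33]),
  (111322311, 23113223, [66, 2101, 1033]),
  (223113223, 11322311, [1120, 33]),
  (231113222, 111322231, [1108, 67]),
  (23222322, 11311131, [88, 8031]),
  (111311131, 3222322, [1126, 31]),
  (222311131, 13222322, [64, 1129]),
  (32223223, 11131132, [8030, 97]),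
  (111311322, 3223113, [132, 4059, 3033]),
  (23223113, 11311322, [1134, 33]),
  (322231132, 231113223, [1064, 2132, 49, 2067]),
  (222311322, 13223113, [64, 1135]),
  (322311132, 231132223, [70, 7048, 103]),
  (32223222, 11131113, [8034, 107]),
  (111311132, 32223111, [144, 5067]),
  (232223111, 11311132, [1146, 33]),
  (222311132, 132223111, [64, 1147]),
  (1132223111, 22311132, [1150, 31]),
  (223222311, 13111322, [110, 8033]),
  (311322311, 22311322, [112, 8033]),
  (1113222311, 23111322, [124, 8033]),
  (311322231, 132231113, [68, 7054, 137, 1071]),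
  (223111322, 113222311, [1158, 33]),
  (4113222, 1132224, [0, 1000, 2004, 3002, 4002, 5002, 6006, 7000, 8000, 9015, 8001, 7001]),
  (43, 34, [2006, 3004, 17]),
  (43, 34, [167]),
  (4113, 1132224111, [4032, 5032, 6032, 165]),
  (4131, 3423, [1054, 167]),
  (4232, 3413, [1048, 167]),
  (41113, 111322411, [5032, 6032, 5030, 3054, 5032, 6032, 165, 6165, 5033, 4033, 2055, 4031]),
  (42223, 1113224132, [5030, 1064, 4054, 6032, 5030, 3054, 5032, 6032, 165, 6165, 5033, 4033,
    2055, 4031]),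
  (42232, 22322314231, [5032, 6034, 7030, 1030, 2094, 5058, 1100, 2056, 6066, 8034, 1120, 5030,
    3054, 5032, 6032, 165, 6165, 12167, 13165, 5033, 4033, 2055, 4031, 121, 7035, 5067, 1057, 101,
    4059, 1095, 31]),
  (42311, 22322314223, [5034, 2032, 3058, 7030, 1030, 2094, 5058, 1100, 2056, 6066, 8034, 1120,
    5030, 3054, 5032, 6032, 165, 6165, 12167, 13165, 5033, 4033, 2055, 4031, 121, 7035, 5067,
    1057, 101, 4059, 1095, 31]),
  (413222, 1311131142231, [3064, 6034, 7030, 8030, 1086, 8030, 1110, 9034, 3066, 6056, 1114, 1030,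
    2138, 3064, 6058, 2030, 3138, 165, 6167, 7165, 13165, 2139, 1031, 5059, 2065, 1139, 31, 115,
    5057, 2067, 8035, 111, 7031, 87]),
  (413223, 11322242231, [2030, 3056, 6030, 4066, 165]),
  (422311, 1311131141322, [6030, 4066, 7034, 1030, 2104, 1086, 8030, 1110, 9034, 3066, 6056, 1114,
    1030, 2138, 3064, 6058, 2030, 3138, 165, 6167, 7165, 13165, 2139, 1031, 5059, 2065, 1139, 31,
    115, 5057, 2067, 8035, 111, 7031, 87]),
  (13113, 0, [5032, 6032, 7034, 100, 1056, 5066, 7034, 120, 66, 3056, 7032, 8036, 9030, 10030, 64,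
    3058, 6032, 4064, 6176, 8036, 9030, 10030, 8030, 9030, 6030, 4066, 6034, 66, 3056, 7032, 8170,
    9032, 10176, 12036, 13030, 14030, 12030, 13030, 9030, 10030, 64, 3058, 6032, 4064, 6176, 8170,
    9032, 10176, 12036, 13030, 14030, 12030, 13030, 9030, 10030, 8030, 9030, 6030, 4066, 6034, 66,
    3056, 7032, 8170, 9032, 10176, 12170, 13032, 14176, 16036, 17030, 18030, 16030, 17030, 13030,
    14030, 12030, 13030, 9030, 10030, 64, 3058, 6032, 4064, 6176, 8170, 9032, 10176, 12170, 13032,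
    14176, 15066, 17034, 14032, 15034, 16030, 11032, 12034, 10034, 11172, 14032, 15032, 11030,
    6034, 7168, 8030, 9030, 2058, 6030, 5032, 6054, 118, 7032, 8176, 9066, 11180, 14032, 12064,
    14178, 17048, 18184, 18030, 11034, 12168, 13032, 14032, 15032, 13064, 12030, 152, 3064, 6054,
    148, 2064, 5184, 2066, 4034, 56, 4032, 5032, 6178, 7064, 9170, 11054, 13032, 14184, 10032,
    11032, 12178, 15048, 12032, 10064, 9030, 7066, 9034, 6032, 7034, 30, 1142, 9030, 7054, 140,
    8182, 11170, 13054, 10174, 11030, 12182, 15178, 18048, 12034, 13172, 16032, 10034, 11174,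
    14030, 64, 1132, 8172, 10030, 11030, 6030, 2064, 5054, 7032, 154, 8170, 11030, 9066, 12180,
    14048, 9064, 110, 3170, 5054, 7172, 10032, 11178, 12064, 13034, 14032, 15184, 19182, 20030,
    29019, 28003, 27003, 26005, 25001, 24001, 23005, 22003, 21003, 3030, 4030, 5034, 6032, 7032,
    154, 8178, 12174, 14032, 15032, 13064, 16178, 20174, 23030, 24036, 25032, 26032, 27034, 27032,
    25064, 17064, 13066, 14034, 9064, 110, 3170, 5054, 7172, 10032, 11170, 14030, 12066, 12064,
    3030, 4030, 5034, 6032, 7032, 154, 8178, 12174, 15030, 9064, 110, 3170, 6030, 4066, 4064,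
    3030, 4030, 2066, 5034, 6032, 7032, 8170, 10054, 130, 6054, 8174, 11180, 13048, 10172, 13170,
    15054, 12174, 15180, 19030, 12034, 13172, 16032, 10034, 11174, 14030, 64, 1132, 8172, 10030,
    11030, 6030, 2064, 5054, 7032, 154, 8170, 11030, 9066, 12180, 14048, 9064, 110, 3170, 5054,
    7172, 10032, 11178, 12064, 13034, 14032, 15184, 13030, 14030, 15036, 16032, 17032, 18032,
    19036, 20030, 30025, 29005, 28003, 27003, 26007, 25001, 24001, 23001, 22007, 21003, 12066,
    14034, 11032, 54, 2174, 4032, 5032, 3064, 6178, 9048, 4034, 5032, 6032, 2032, 3032, 4034,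
    5032, 6032, 128, 6188, 6030, 4066, 6034, 66, 3056, 7032, 8186, 64, 1132, 4056, 8032, 7030,
    8048, 160, 8032, 6048, 7188, 12184, 32, 1100, 6032, 4064, 6034, 7032, 8184, 64, 3058, 6032,
    4064, 6178, 7064, 8178, 10182, 14036, 15030, 16034, 10032, 11034, 12030, 7032, 8034, 6034,
    7172, 10032, 11032, 2058, 6030, 5032, 6054, 118, 7032, 8178, 11048, 12184, 12030, 152, 3064,
    6054, 148, 2064, 5184, 2066, 4034, 56, 4032, 5032, 6178, 9048, 6032, 7034, 30, 1142, 9030,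
    7054, 140, 8182, 11178, 14048, 64, 1132, 8172, 11032, 2064, 3178, 4064, 5034, 6032, 7184,
    11180, 13048, 15174, 18030, 12030, 13034, 54, 2174, 4032, 5032, 3064, 6178, 10174, 13030,
    14180, 17032, 15064, 7064, 3066, 4034, 30, 1048, 3172, 6032, 7170, 10030, 8066, 8064, 54,
    2174, 5030, 2032, 3034, 4030, 5030, 6034, 134, 7180, 9048, 6172, 9170, 11054, 8174, 11180,
    15030, 8034, 9172, 12032, 6034, 7174, 10030, 7032, 132, 2180, 4048, 30, 1048, 3172, 6032,
    7178, 8064, 9034, 10032, 11184, 10032, 11032, 7032, 2032, 1030, 2048, 3032, 4032, 5034, 2030,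
    3056, 7188, 2058, 6030, 7030, 122, 156, 7186, 32, 1100, 6032, 4064, 6034, 7032, 8188, 64,
    1132, 4056, 7030, 1070, 136, 56, 4066, 6182, 6032, 7034, 30, 1142, 9030, 7054, 140, 8180,
    10048, 11188, 11030, 64, 1132, 4056, 7030, 1070, 136, 56, 4066, 6180, 10030, 32, 1058, 4032,
    2064, 5186, 1032, 2054, 4032, 5032, 3064, 6034, 7032, 8188, 12186, 152, 9034, 162, 1138, 2064,
    5058, 6182, 8032, 9032, 7064, 6030, 7030, 116, 4064, 6170, 8188, 13036, 14030, 15034, 16032,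
    17032, 18036, 19032, 20032, 21032, 22036, 23030, 40025, 39001, 38001, 37001, 36005, 35001,
    34007, 33003, 32005, 31001, 30001, 29007, 28001, 27001, 26001, 25007, 24003, 19064, 8030,
    9030, 7066, 7064, 6030, 4066, 6034, 66, 3056, 7032, 8170, 10054, 12032, 64, 1132, 4056, 8032,
    7030, 8048, 160, 8032, 6048, 7188, 12186, 17174, 19032, 20032, 21170, 18064, 7030, 112, 5030,
    6048, 7032, 8186, 13174, 15032, 16032, 17170, 14064, 3066, 6048, 8174, 10032, 11032, 12170,
    9064, 110, 3170, 21]),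
  (12, 0, [1]),
  (21, 0, [3]),
  (33, 0, [5]),
  (44, 0, [7]),
  (1111111, 0, [9]),
  (131313, 0, [11]),
  (4343, 0, [17]),
  (322411322411322411322411322411, 0, [19]),
  (13113, 0, [191]),
  (343, 4, [198, 1205]),
  (43, 34, [196, 1211]),
  (3113, 2, [194, 1209]),
  (113, 32, [196, 1215]),
  (32234222342223422234222411, 0, [18212, 19216, 13212, 14216, 8212, 9216, 3212, 4216, 207]),
  (232, 13, [1216, 195]),
  (131, 23, [220, 2195]),
  (3, 0, [194, 1196, 222, 203]),
  (11, 2, [2224, 217, 225]),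
  (1, 0, [194, 226, 194, 226, 201]),
  (2, 0, [228, 193]),
  (4, 0, [1228, 1228, 230, 230, 230, 198, 1224, 1230, 1230, 1230, 224, 230, 230, 230, 198, 1224,
    1230, 1230, 1230, 224, 230, 230, 224, 219])]

set_option maxRecDepth 100000 in
theorem verify_comm : verify baseRules certComm goalRules = true := by decide +kernel

set_option maxRecDepth 100000 in
theorem verify_triv :
    verify (baseRules ++ extraRules) certTriv [(1, 0), (3, 0), (4, 0)] = true := by
  decide +kernel

/-- The base rules hold in every group to which `F` maps with the relators being killed. -/
theorem base_valid {H : Type*} [Group H] (f : F →* H) (hf : ∀ r ∈ rels, f r = 1) :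
    ∀ e ∈ baseRules, ev (f fx) (f fy) (f ft) (wd e.1) = ev (f fx) (f fy) (f ft) (wd e.2) := by
  have h1 : f (fx ^ 7) = 1 := hf _ (by simp [rels])
  have h2 : f (fy ^ 2) = 1 := hf _ (by simp [rels])
  have h3 : f ((fx * fy) ^ 3) = 1 := hf _ (by simp [rels])
  have h4 : f ((fcomm fx fy) ^ 4) = 1 := hf _ (by simp [rels])
  have h5 : f (ft ^ 2) = 1 := hf _ (by simp [rels])
  have h6 : f (fcomm (fconj ft (fx ^ 2)) (fy * fx⁻¹)) = 1 := hf _ (by simp [rels])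
  have h7 : f (fcomm ft fy) = 1 := hf _ (by simp [rels])
  have h8 : f ((fy * fconj ft (fx ^ 2)) ^ 5) = 1 := hf _ (by simp [rels])
  have h9 : f ((fx * fy * fx ^ 2 * fconj ft fx) ^ 5) = 1 := hf _ (by simp [rels])
  have h10 : f ((fx * ft) ^ 8) = 1 := hf _ (by simp [rels])
  simp only [fcomm, fconj, map_mul, map_pow, map_inv] at h1 h2 h3 h4 h5 h6 h7 h8 h9 h10
  generalize f fx = a at *
  generalize f fy = b at *
  generalize f ft = c at *
  have hb : b⁻¹ = b := by rw [inv_eq_iff_mul_eq_one, ← sq, h2]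
  have hc : c⁻¹ = c := by rw [inv_eq_iff_mul_eq_one, ← sq, h5]
  have hbb : b * b = 1 := by rw [← sq, h2]
  have hcc : c * c = 1 := by rw [← sq, h5]
  simp only [mul_inv_rev, inv_inv, hb, hc, pow_succ, pow_zero, one_mul, mul_assoc,
    mul_inv_cancel_left] at h1 h3 h4 h6 h7 h8 h9 h10
  intro e he
  simp only [baseRules, List.mem_cons, List.not_mem_nil, or_false] at he
  rcases he with rfl | rfl | rfl | rfl | rfl | rfl | rfl | rfl | rfl | rfl | rfl | rfl <;>
    simp [wd, decode, ev, letter, hbb, hcc] <;> assumption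

theorem mk_rels : ∀ r ∈ rels, PresentedGroup.mk rels r = 1 := fun _ hr =>
  PresentedGroup.one_of_mem hr

theorem y_inv : y⁻¹ = y := by
  have h : y ^ 2 = 1 := mk_rels (fy ^ 2) (by simp [rels])
  rw [inv_eq_iff_mul_eq_one, ← sq, h]

theorem s_one : s 1 = ev x y t (wd 2413222224111113) := by
  simp [s, tt, wd, decode, ev, letter, y_inv, pow_succ, mul_assoc]

theorem s_two : s 2 = ev x y t (wd 224132222241111131) := by
  simp [s, tt, wd, decode, ev, letter, y_inv, pow_succ, mul_assoc]

theorem s_seven : s 7 = ev x y t (wd 2222222413222224111113111111) := by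
  simp [s, tt, wd, decode, ev, letter, y_inv, pow_succ, mul_assoc]

theorem comm_all : s 1 * s 2 = s 2 * s 1 ∧ s 7 * s 1 = s 1 * s 7 ∧ s 2 * s 7 = s 7 * s 2 := by
  have h := verify_sound x y t baseRules certComm goalRules
    (base_valid (PresentedGroup.mk rels) mk_rels) verify_comm
  rw [s_one, s_two, s_seven]
  simp only [← ev_append]
  exact ⟨h (2413222224111113224132222241111131, 2241322222411111312413222224111113)
      (by simp [goalRules]),
    h (22222224132222241111131111112413222224111113, 24132222241111132222222413222224111113111111)
      (by simp [goalRules]),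
    h (2241322222411111312222222413222224111113111111,
      2222222413222224111113111111224132222241111131) (by simp [goalRules])⟩

theorem gens_mem (N : Subgroup G) [N.Normal] (h1 : s 1 ∈ N) (h2 : s 2 ∈ N) (h7 : s 7 ∈ N) :
    x ∈ N ∧ y ∈ N ∧ t ∈ N := by
  let q : G →* G ⧸ N := QuotientGroup.mk' N
  have hev : ∀ w, ev (q x) (q y) (q t) w = q (ev x y t w) := by
    intro w
    induction w with
    | nil => simp [ev]
    | cons a w ih =>
      rw [ev_cons, ev_cons, map_mul, ih]
      congr 1
      unfold letter
      split <;> simp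
  have hq : ∀ g : G, q g = 1 ↔ g ∈ N := fun g => QuotientGroup.eq_one_iff g
  have h := verify_sound (q x) (q y) (q t) (baseRules ++ extraRules) certTriv
    [(1, 0), (3, 0), (4, 0)] (by
      intro e he
      rcases List.mem_append.1 he with he | he
      · exact base_valid (q.comp (PresentedGroup.mk rels))
          (fun r hr => by rw [MonoidHom.comp_apply, mk_rels r hr, map_one]) e he
      · simp only [extraRules, List.mem_cons, List.not_mem_nil, or_false] at he
        rcases he with rfl | rfl | rfl
        · rw [hev, ← s_one, (hq _).2 h1]; rfl
        · rw [hev, ← s_two, (hq _).2 h2]; rfl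
        · rw [hev, ← s_seven, (hq _).2 h7]; rfl) verify_triv
  have hx := h (1, 0) (by simp)
  have hy := h (3, 0) (by simp)
  have ht := h (4, 0) (by simp)
  simp [wd, decode, ev, letter] at hx hy ht
  exact ⟨(hq _).1 hx, (hq _).1 hy, (hq _).1 ht⟩

/-- The subgroup `K = ⟨s₁, s₂, s₇⟩` is commutative, and the normal closure of
`{s₁, s₂, s₇}` in `G` is all of `G`. -/
theorem K_abelian_normal_closure :
    (∀ a ∈ Subgroup.closure ({s 1, s 2, s 7} : Set G),
      ∀ b ∈ Subgroup.closure ({s 1, s 2, s 7} : Set G), a * b = b * a) ∧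
    Subgroup.normalClosure ({s 1, s 2, s 7} : Set G) = ⊤ := by
  obtain ⟨h12, h71, h27⟩ := comm_all
  constructor
  · have hc : ∀ a ∈ ({s 1, s 2, s 7} : Set G), ∀ b ∈ ({s 1, s 2, s 7} : Set G),
        a * b = b * a := by
      rintro a (rfl | rfl | rfl) b (rfl | rfl | rfl) <;>
        first | rfl | assumption | (symm; assumption)
    intro a ha b hb
    have := Subgroup.isMulCommutative_closure hc
    exact congrArg Subtype.val (mul_comm' (⟨a, ha⟩ : Subgroup.closure ({s 1, s 2, s 7} : Set G)) ⟨b, hb⟩)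
  · obtain ⟨hx, hy, ht⟩ := gens_mem (Subgroup.normalClosure ({s 1, s 2, s 7} : Set G))
      (Subgroup.subset_normalClosure (by simp)) (Subgroup.subset_normalClosure (by simp))
      (Subgroup.subset_normalClosure (by simp))
    rw [eq_top_iff, ← PresentedGroup.closure_range_of rels, Subgroup.closure_le]
    rintro _ ⟨i, rfl⟩
    fin_cases i
    · exact hx
    · exact hy
    · exact ht


end M22
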